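/- arXiv:1710.07040 — 2 statements merged into one kernel-verified Lean document; each statement's English description precedes it below -/
import Mathlib

section
/- Approximation reduction via tight dual constraints: let (G, w, p, r) be a PCST instance with n = |V| ≥ 2, and let y be a dual feasible solution. Suppose F' ⊆ E is a set of edges such that Σ_{S : e ∈ δ(S)} y_S = w_e for every e ∈ F', and C_1, …, C_z are pairwise disjoint nonempty subsets of V \ {r} such that Σ_{S ⊆ C_j} y_S = Σ_{v ∈ C_j} p_v for every j; let X = C_1 ∪ ⋯ ∪ C_z. If Σ_{e ∈ F'} Σ_{S : e ∈ δ(S)} y_S + Σ_{j=1}^{z} Σ_{S ⊆ C_j} y_S ≤ (2 − 1/(n−1)) · Σ_S y_S, then Σ_{e ∈ F'} w_e + Σ_{v ∈ X} p_v ≤ (2 − 1/(n−1)) · Σ_S y_S ≤ (2 − 1/(n−1)) · GW(T') for every subtree T' of G containing r (all sums over S range over nonempty subsets of V \ {r}). -/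
open Finset
open scoped Classical

variable {V : Type*} [Fintype V] [DecidableEq V]

/-- An edge `e` crosses the vertex set `S` if exactly one of its endpoints lies in `S`. -/
def crosses (S : Finset V) (e : Sym2 V) : Prop :=
  ∃ u v, e = s(u, v) ∧ u ∈ S ∧ v ∉ S

/-- The index set of the dual LP variables: nonempty subsets of `V \ {r}`. -/
def dualSets (r : V) : Finset (Finset V) :=
  (Finset.univ.erase r).powerset.filter Finset.Nonempty

/-- Dual feasibility for the PCST LP relaxation: nonnegativity, edge packing
constraints, and penalty packing constraints. -/
def DualFeasible (G : SimpleGraph V) (w : Sym2 V → ℝ) (p : V → ℝ) (r : V)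
    (y : Finset V → ℝ) : Prop :=
  (∀ S ∈ dualSets r, 0 ≤ y S) ∧
  (∀ e ∈ G.edgeSet, ∑ S ∈ (dualSets r).filter (fun S => crosses S e), y S ≤ w e) ∧
  (∀ U ∈ dualSets r, ∑ S ∈ (dualSets r).filter (fun S => S ⊆ U), y S ≤ ∑ v ∈ U, p v)

/-- Primal feasibility for the PCST LP relaxation. -/
def PrimalFeasible (G : SimpleGraph V) [DecidableRel G.Adj] (r : V)
    (x : Sym2 V → ℝ) (z : Finset V → ℝ) : Prop :=
  (∀ e ∈ G.edgeSet, 0 ≤ x e) ∧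
  (∀ U ∈ dualSets r, 0 ≤ z U) ∧
  (∀ S ∈ dualSets r,
      1 ≤ ∑ e ∈ G.edgeFinset.filter (fun e => crosses S e), x e +
          ∑ U ∈ (dualSets r).filter (fun U => S ⊆ U), z U)

/-- `(V', E')` is a subtree of `G` containing the root `r`: its edges are edges of `G`
with both endpoints in `V'`, it is connected, and it is acyclic. -/
def IsRootedSubtree (G : SimpleGraph V) (r : V) (V' : Finset V)
    (E' : Finset (Sym2 V)) : Prop :=
  r ∈ V' ∧
  (∀ e ∈ E', e ∈ G.edgeSet) ∧
  (∀ e ∈ E', ∀ u ∈ e, u ∈ V') ∧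
  (∀ u ∈ V', ∀ v ∈ V', (SimpleGraph.fromEdgeSet (E' : Set (Sym2 V))).Reachable u v) ∧
  (SimpleGraph.fromEdgeSet (E' : Set (Sym2 V))).IsAcyclic

/-- If a walk in the graph spanned by `E'` leaves `S`, then some edge of `E'` crosses `S`. -/
lemma exists_crosses_of_reachable {E' : Set (Sym2 V)} {S : Finset V} {u r : V}
    (h : (SimpleGraph.fromEdgeSet E').Reachable u r) (hu : u ∈ S) (hr : r ∉ S) :
    ∃ e ∈ E', crosses S e := by
  obtain ⟨walk⟩ := h
  obtain ⟨d, -, hd₁, hd₂⟩ :=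
    walk.exists_boundary_dart (S : Set V) (by simpa using hu) (by simpa using hr)
  exact ⟨s(d.fst, d.snd), ((SimpleGraph.fromEdgeSet_adj _).1 d.adj).1, d.fst, d.snd, rfl,
    by simpa using hd₁, by simpa using hd₂⟩

/-- A set in `dualSets r` either misses the vertices of a rooted subtree or is crossed by
one of its edges. -/
lemma IsRootedSubtree.subset_compl_or_exists_crosses {G : SimpleGraph V} {r : V}
    {V' : Finset V} {E' : Finset (Sym2 V)} (hT : IsRootedSubtree G r V' E')
    {S : Finset V} (hS : S ∈ dualSets r) :
    S ⊆ Finset.univ \ V' ∨ ∃ e ∈ E', crosses S e := by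
  obtain ⟨hr, -, -, hconn, -⟩ := hT
  have hrS : r ∉ S := fun h => by
    have := (Finset.mem_powerset.1 (Finset.mem_filter.1 hS).1) h
    simp at this
  by_cases hsub : S ⊆ Finset.univ \ V'
  · exact Or.inl hsub
  · obtain ⟨u, huS, hu⟩ := Finset.not_subset.1 hsub
    have huV : u ∈ V' := by simpa using hu
    exact Or.inr (exists_crosses_of_reachable (hconn u huV r hr) huS hrS)

/-- Weak duality: the dual objective is at most the GW-value of any rooted subtree. -/
lemma DualFeasible.sum_le_gwValue {G : SimpleGraph V} {w : Sym2 V → ℝ} {p : V → ℝ} {r : V}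
    {y : Finset V → ℝ} (hy : DualFeasible G w p r y) (hp : ∀ v, 0 ≤ p v)
    {V' : Finset V} {E' : Finset (Sym2 V)} (hT : IsRootedSubtree G r V' E') :
    ∑ S ∈ dualSets r, y S ≤ ∑ e ∈ E', w e + ∑ v ∈ Finset.univ \ V', p v := by
  obtain ⟨hy₀, hyE, hyP⟩ := hy
  have hedge : ∑ e ∈ E', ∑ S ∈ (dualSets r).filter (fun S => crosses S e), y S ≤
      ∑ e ∈ E', w e :=
    Finset.sum_le_sum fun e he => hyE e (hT.2.1 e he)
  have hpen : ∑ S ∈ (dualSets r).filter (fun S => S ⊆ Finset.univ \ V'), y S ≤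
      ∑ v ∈ Finset.univ \ V', p v := by
    by_cases hU : Finset.univ \ V' ∈ dualSets r
    · exact hyP _ hU
    · rw [Finset.sum_eq_zero]
      · exact Finset.sum_nonneg fun v _ => hp v
      · intro S hS
        obtain ⟨hS, hsub⟩ := Finset.mem_filter.1 hS
        refine absurd ?_ hU
        refine Finset.mem_filter.2 ⟨Finset.mem_powerset.2 fun v hv => ?_,
          (Finset.mem_filter.1 hS).2.mono hsub⟩
        have hvV : v ∉ V' := (Finset.mem_sdiff.1 hv).2
        exact Finset.mem_erase.2 ⟨fun h => hvV (h ▸ hT.1), Finset.mem_univ v⟩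
  refine le_trans ?_ (add_le_add hedge hpen)
  simp only [Finset.sum_filter]
  rw [Finset.sum_comm, ← Finset.sum_add_distrib]
  refine Finset.sum_le_sum fun S hS => ?_
  have hyS := hy₀ S hS
  have hterm : ∀ e ∈ E', 0 ≤ if crosses S e then y S else 0 := fun e _ => by
    split_ifs <;> simp [hyS]
  rcases hT.subset_compl_or_exists_crosses hS with hsub | ⟨e, he, hc⟩
  · rw [if_pos hsub]
    exact le_add_of_nonneg_left (Finset.sum_nonneg hterm)
  · have hle := Finset.single_le_sum hterm he
    rw [if_pos hc] at hle
    exact le_add_of_le_of_nonneg hle (by split_ifs <;> simp [hyS])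

/-- **Approximation reduction via tight dual constraints.** If `F'` consists of edges
whose dual edge-packing constraints are tight, the `C j` are pairwise disjoint nonempty
subsets of `V \ {r}` whose penalty-packing constraints are tight, and the combined
tight sums are at most `(2 - 1/(n-1))` times the dual objective, then the cost of
`(F', X)` is at most `(2 - 1/(n-1))` times the dual objective, which in turn is at
most `(2 - 1/(n-1))` times the GW-value of any subtree containing the root. -/
theorem approx_reduction_via_tight_duals
    (G : SimpleGraph V) [DecidableRel G.Adj]
    (w : Sym2 V → ℝ) (p : V → ℝ) (r : V)
    (hG : G.Connected)
    (hw : ∀ e ∈ G.edgeSet, 0 ≤ w e) (hp : ∀ v, 0 ≤ p v)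
    (hn : 2 ≤ Fintype.card V)
    (y : Finset V → ℝ) (hy : DualFeasible G w p r y)
    (F' : Finset (Sym2 V)) (hF' : ∀ e ∈ F', e ∈ G.edgeSet)
    (htight : ∀ e ∈ F',
        ∑ S ∈ (dualSets r).filter (fun S => crosses S e), y S = w e)
    (z : ℕ) (C : Fin z → Finset V)
    (hCne : ∀ j, (C j).Nonempty)
    (hCsub : ∀ j, C j ⊆ Finset.univ.erase r)
    (hCdisj : ∀ i j, i ≠ j → Disjoint (C i) (C j))
    (hCtight : ∀ j,
        ∑ S ∈ (dualSets r).filter (fun S => S ⊆ C j), y S = ∑ v ∈ C j, p v)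
    (hmain : ∑ e ∈ F', ∑ S ∈ (dualSets r).filter (fun S => crosses S e), y S +
          ∑ j : Fin z, ∑ S ∈ (dualSets r).filter (fun S => S ⊆ C j), y S ≤
        (2 - 1 / ((Fintype.card V : ℝ) - 1)) * ∑ S ∈ dualSets r, y S) :
    (∑ e ∈ F', w e + ∑ v ∈ Finset.univ.biUnion C, p v ≤
        (2 - 1 / ((Fintype.card V : ℝ) - 1)) * ∑ S ∈ dualSets r, y S) ∧
    (∀ (V' : Finset V) (E' : Finset (Sym2 V)), IsRootedSubtree G r V' E' →
        (2 - 1 / ((Fintype.card V : ℝ) - 1)) * ∑ S ∈ dualSets r, y S ≤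
          (2 - 1 / ((Fintype.card V : ℝ) - 1)) *
            (∑ e ∈ E', w e + ∑ v ∈ Finset.univ \ V', p v)) := by
  refine ⟨?_, fun V' E' hT => ?_⟩
  · rw [Finset.sum_congr rfl htight, Finset.sum_congr rfl fun j _ => hCtight j] at hmain
    rwa [Finset.sum_biUnion fun i _ j _ hij => hCdisj i j hij]
  · refine mul_le_mul_of_nonneg_left (hy.sum_le_gwValue hp hT) ?_
    have hcard : (1 : ℝ) ≤ (Fintype.card V : ℝ) - 1 := by
      have : (2 : ℝ) ≤ Fintype.card V := by exact_mod_cast hn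
      linarith
    have := div_le_one_of_le₀ hcard (by linarith)
    linarith
end

section
/- Forest degree-counting lemma, approximation-factor form: let H be a finite simple graph that is acyclic and has at least one edge, whose vertex set is partitioned into two sets N_A and N_I, such that every vertex of N_I has degree at least 1 and at most one vertex of N_I has degree exactly 1 (every other vertex of N_I has degree at least 2). Let A' = {v ∈ N_A : deg(v) ≥ 1}. If n ≥ 2 is an integer with 1 ≤ |A'| ≤ n − 1, then Σ_{v ∈ A'} deg(v) ≤ (2 − 1/(n−1)) · |A'|. -/
open Finset
open scoped Classical

/-- A finite nonempty acyclic graph has fewer edges than vertices. -/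
theorem SimpleGraph.IsAcyclic.card_edgeFinset_lt_card {V : Type*} [Fintype V]
    {G : SimpleGraph V} [DecidableRel G.Adj] (hG : G.IsAcyclic) [Nonempty V] :
    #G.edgeFinset < Fintype.card V := by
  obtain ⟨T, hGT, -, hT⟩ :=
    SimpleGraph.connected_top.exists_isTree_le_of_le_of_isAcyclic le_top hG
  have hle : #G.edgeFinset ≤ #T.edgeFinset :=
    card_le_card (SimpleGraph.edgeFinset_mono hGT)
  have hcard := hT.card_edgeFinset
  omega

/-- A finite acyclic graph has fewer edges than any nonempty set containing its support has
vertices. -/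
theorem SimpleGraph.IsAcyclic.card_edgeFinset_lt_card_of_support_subset {V : Type*} [Fintype V]
    {G : SimpleGraph V} [DecidableRel G.Adj] (hG : G.IsAcyclic) {s : Finset V}
    (hs : s.Nonempty) (hsupp : G.support ⊆ s) : #G.edgeFinset < #s := by
  have : Nonempty (s : Set V) := hs.to_subtype
  have hlt := (hG.induce (s : Set V)).card_edgeFinset_lt_card
  have hcard := SimpleGraph.card_edgeFinset_induce_of_support_subset hsupp
  have hs' : Fintype.card (s : Set V) = #s := by simp
  rw [hs'] at hlt
  rw [← hcard]
  convert hlt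

/-- A sum of positive naturals, at most one of which equals one, is at least twice the number of
terms minus one. -/
theorem Finset.two_mul_card_le_sum_add_one {ι : Type*} {s : Finset ι} {f : ι → ℕ}
    (hpos : ∀ i ∈ s, 1 ≤ f i) (hone : ∀ i ∈ s, ∀ j ∈ s, f i = 1 → f j = 1 → i = j) :
    2 * #s ≤ ∑ i ∈ s, f i + 1 := by
  have hsmall : #(s.filter (fun i => f i = 1)) ≤ 1 :=
    card_le_one.mpr fun i hi j hj => by
      rw [mem_filter] at hi hj
      exact hone i hi.1 j hj.1 hi.2 hj.2
  have hle : ∑ _i ∈ s, 2 ≤ ∑ i ∈ s, (f i + if f i = 1 then 1 else 0) :=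
    sum_le_sum fun i hi => by
      have := hpos i hi
      split_ifs <;> omega
  rw [sum_add_distrib, ← card_filter, sum_const, smul_eq_mul] at hle
  omega

/-- **Forest degree-counting lemma, approximation-factor form.** With `H`, `NA`, `NI` as
in the degree-counting lemma and `A'` the set of vertices of `NA` of positive degree,
if `n ≥ 2` and `1 ≤ |A'| ≤ n - 1`, then `∑_{v ∈ A'} deg v ≤ (2 - 1/(n-1))·|A'|`. -/
theorem forest_degree_count_ratio
    {W : Type*} [Fintype W] [DecidableEq W]
    (H : SimpleGraph W) [DecidableRel H.Adj]
    (hacyclic : H.IsAcyclic)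
    (hedge : H.edgeFinset.Nonempty)
    (NA NI : Finset W)
    (hdisj : Disjoint NA NI) (hcover : NA ∪ NI = Finset.univ)
    (hNI : ∀ v ∈ NI, 1 ≤ H.degree v)
    (hNIone : ∀ u ∈ NI, ∀ v ∈ NI, H.degree u = 1 → H.degree v = 1 → u = v)
    (A' : Finset W) (hA' : A' = NA.filter (fun v => 1 ≤ H.degree v))
    (n : ℕ) (hn : 2 ≤ n)
    (hA1 : 1 ≤ A'.card) (hA2 : A'.card ≤ n - 1) :
    ∑ v ∈ A', (H.degree v : ℝ) ≤ (2 - 1 / ((n : ℝ) - 1)) * A'.card := by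
  have hdisj' : Disjoint A' NI :=
    disjoint_of_subset_left (hA' ▸ filter_subset _ _) hdisj
  have hmem : ∀ v, v ∉ A' ∪ NI → H.degree v = 0 := fun v hv => by
    have hv' : v ∈ NA ∪ NI := hcover ▸ mem_univ v
    simp only [hA', mem_union, mem_filter] at hv hv'
    grind
  have hsupp : H.support ⊆ (A' ∪ NI : Finset W) := fun v hv => by
    by_contra hvn
    have := (H.degree_pos_iff_mem_support v).mpr hv
    have := hmem v hvn
    omega
  have hedges := hacyclic.card_edgeFinset_lt_card_of_support_subset
    ((card_pos.mp hA1).mono subset_union_left) hsupp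
  rw [card_union_of_disjoint hdisj'] at hedges
  have hsum : ∑ v ∈ A', H.degree v + ∑ v ∈ NI, H.degree v = 2 * #H.edgeFinset := by
    rw [← sum_union hdisj', ← H.sum_degrees_eq_twice_card_edges]
    exact sum_subset (subset_univ _) fun v _ hv => hmem v hv
  have hNIsum := two_mul_card_le_sum_add_one hNI hNIone
  have hnat : ∑ v ∈ A', H.degree v + 1 ≤ 2 * #A' := by omega
  have hreal : ∑ v ∈ A', (H.degree v : ℝ) + 1 ≤ 2 * #A' := mod_cast hnat
  have hn1 : (0 : ℝ) < (n : ℝ) - 1 := by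
    have : (2 : ℝ) ≤ n := mod_cast hn
    linarith
  have hratio : (#A' : ℝ) / ((n : ℝ) - 1) ≤ 1 := by
    rw [div_le_one hn1, le_sub_iff_add_le]
    exact_mod_cast (by omega : #A' + 1 ≤ n)
  calc ∑ v ∈ A', (H.degree v : ℝ) ≤ 2 * #A' - 1 := by linarith
    _ ≤ 2 * #A' - #A' / ((n : ℝ) - 1) := by linarith
    _ = (2 - 1 / ((n : ℝ) - 1)) * #A' := by ring
end
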